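/- arXiv:1309.3251 — 4 statements merged into one kernel-verified Lean document; each statement's English description precedes it below -/
import Mathlib

section
/- Let n ≥ 1 and let S ⊆ ℤⁿ be a finite set. Then the number of edges in the edge boundary of S in the graph Gₙ equals the sum, over all ε ∈ {-1,0,1}ⁿ with ε ≠ 0, of |P_ε(S)| + |gap_ε(S)|. That is, |∂_e(S)| = Σ_{ε ∈ {-1,0,1}ⁿ, ε≠0} ( |P_ε(S)| + |gap_ε(S)| ). -/
/-- The number of edges in the edge boundary of `S` in the graph `Gₙ`
(vertices `ℤⁿ`, edges between points at `ℓ∞`-distance 1), counted as the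
number of ordered pairs `(u, v)` with `u ∈ S`, `v ∉ S`, `‖u - v‖_∞ = 1`. -/
noncomputable def edgeBoundaryCard (n : ℕ) (S : Set (Fin n → ℤ)) : ℕ :=
  Set.ncard {p : (Fin n → ℤ) × (Fin n → ℤ) |
    p.1 ∈ S ∧ p.2 ∉ S ∧ p.1 ≠ p.2 ∧ ∀ i, |p.1 i - p.2 i| ≤ 1}

/-- `gap_ε(S) = {x ∈ ℤⁿ : x - ε ∈ S, x ∉ S, x + bε ∈ S for some b ≥ 1}`. -/
def gapSet (n : ℕ) (S : Set (Fin n → ℤ)) (ε : Fin n → ℤ) : Set (Fin n → ℤ) :=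
  {x | x - ε ∈ S ∧ x ∉ S ∧ ∃ b : ℤ, 1 ≤ b ∧ x + b • ε ∈ S}

/-- `|P_ε(S)|`: the number of equivalence classes of `S` under
`u ~ v ↔ u - v` is an integer multiple of `ε`. -/
noncomputable def projCard (n : ℕ) (S : Set (Fin n → ℤ)) (ε : Fin n → ℤ) : ℕ :=
  Set.ncard ((QuotientAddGroup.mk (s := AddSubgroup.zmultiples ε)) '' S)

/-- The finite set of directions `ε ∈ {-1,0,1}ⁿ`, `ε ≠ 0`. -/
def directions (n : ℕ) : Finset (Fin n → ℤ) :=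
  (Fintype.piFinset fun _ : Fin n => ({-1, 0, 1} : Finset ℤ)).erase 0

section Lines

variable {G : Type*} [AddCommGroup G] {S : Set G} {ε : G}

/-- The set of points outside `S` reached from `S` by a step in direction `ε` is finite. -/
theorem finite_setOf_sub_mem_and_notMem (hS : S.Finite) (ε : G) :
    {x | x - ε ∈ S ∧ x ∉ S}.Finite :=
  (hS.preimage (sub_left_injective (b := ε)).injOn).subset fun _ hx => hx.1

/-- Every class of `S` modulo multiples of `ε` contains exactly one point of `S` after which the
line in direction `ε` never meets `S` again. -/
theorem bijOn_lastExit_mk_image (hS : S.Finite) (hε : Function.Injective fun k : ℤ => k • ε) :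
    Set.BijOn (fun x => QuotientAddGroup.mk (s := AddSubgroup.zmultiples ε) (x - ε))
      {x | x - ε ∈ S ∧ x ∉ S ∧ ∀ b : ℤ, 1 ≤ b → x + b • ε ∉ S}
      (QuotientAddGroup.mk (s := AddSubgroup.zmultiples ε) '' S) := by
  have not_pos : ∀ (x : G) (k : ℤ), x ∉ S → (∀ b : ℤ, 1 ≤ b → x + b • ε ∉ S) → x + k • ε - ε ∈ S →
      k ≤ 0 := by
    intro x k hx hlast hk
    by_contra! hpos
    have heq : x + k • ε - ε = x + (k - 1) • ε := by rw [sub_smul, one_smul]; abel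
    rw [heq] at hk
    rcases (show k = 1 ∨ 1 ≤ k - 1 by omega) with rfl | h
    · exact hx (by simpa using hk)
    · exact hlast _ h hk
  refine ⟨fun x hx => ⟨_, hx.1, rfl⟩, ?_, ?_⟩
  · rintro x ⟨hxS, hx, hxl⟩ y ⟨hyS, hy, hyl⟩ hxy
    obtain ⟨k, hk⟩ := AddSubgroup.mem_zmultiples_iff.1 (QuotientAddGroup.eq.1 hxy)
    have hyx : y = x + k • ε := by rw [hk]; abel
    have hxy : x = y + (-k) • ε := by rw [neg_smul, hk]; abel
    have h₁ := not_pos x k hx hxl (hyx ▸ hyS)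
    have h₂ := not_pos y (-k) hy hyl (hxy ▸ hxS)
    obtain rfl : k = 0 := by omega
    simpa using hyx.symm
  · rintro _ ⟨s, hs, rfl⟩
    have hfin : {k : ℤ | s + k • ε ∈ S}.Finite :=
      hS.preimage ((add_right_injective s).comp hε).injOn
    obtain ⟨k, hk, hmax⟩ := hfin.exists_maximalFor id _ ⟨0, by simpa using hs⟩
    have later : ∀ m : ℤ, k < m → s + m • ε ∉ S := fun m hm hmS =>
      absurd (hmax hmS hm.le) (not_le.2 hm)
    refine ⟨s + (k + 1) • ε, ⟨?_, later _ (by omega), fun b hb => ?_⟩, ?_⟩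
    · have : s + (k + 1) • ε - ε = s + k • ε := by rw [add_smul, one_smul]; abel
      rw [this]
      exact hk
    · rw [add_assoc, ← add_smul]
      exact later _ (by omega)
    · refine QuotientAddGroup.eq.2 (AddSubgroup.mem_zmultiples_iff.2 ⟨-k, ?_⟩)
      rw [add_smul, one_smul, neg_smul]
      abel

end Lines

theorem ncard_exits_eq_projCard_add_ncard_gapSet {n : ℕ} {S : Set (Fin n → ℤ)} (hS : S.Finite)
    {ε : Fin n → ℤ} (hε : ε ≠ 0) :
    {x | x - ε ∈ S ∧ x ∉ S}.ncard = projCard n S ε + (gapSet n S ε).ncard := by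
  have hfin := finite_setOf_sub_mem_and_notMem hS ε
  have hbij := bijOn_lastExit_mk_image hS (smul_left_injective ℤ hε)
  rw [projCard, ← hbij.image_eq, hbij.injOn.ncard_image, ← Set.ncard_union_eq ?_
    (hfin.subset fun x hx => ⟨hx.1, hx.2.1⟩) (hfin.subset fun x hx => ⟨hx.1, hx.2.1⟩)]
  · congr 1
    ext x
    simp only [gapSet, Set.mem_union, Set.mem_ofPred_eq]
    grind
  · rw [Set.disjoint_left]
    rintro x ⟨-, -, hx⟩ ⟨-, -, b, hb, hxb⟩
    exact hx b hb hxb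

theorem mem_directions {n : ℕ} {ε : Fin n → ℤ} :
    ε ∈ directions n ↔ ε ≠ 0 ∧ ∀ i, |ε i| ≤ 1 := by
  simp only [directions, Finset.mem_erase, Fintype.mem_piFinset, Finset.mem_insert,
    Finset.mem_singleton, abs_le]
  refine and_congr_right fun _ => forall_congr' fun i => ?_
  omega

theorem edgeBoundaryCard_eq_sum_ncard_exits {n : ℕ} {S : Set (Fin n → ℤ)} (hS : S.Finite) :
    edgeBoundaryCard n S = ∑ ε ∈ directions n, {x | x - ε ∈ S ∧ x ∉ S}.ncard := by
  have hfin := finite_setOf_sub_mem_and_notMem hS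
  let f : (_ : Fin n → ℤ) × (Fin n → ℤ) → (Fin n → ℤ) × (Fin n → ℤ) := fun p => (p.2 - p.1, p.2)
  have hf : Function.Injective f := by
    rintro ⟨ε, x⟩ ⟨δ, y⟩ h
    obtain ⟨h₁, rfl⟩ := Prod.mk.inj h
    obtain rfl := sub_right_injective h₁
    rfl
  have himage : {p : (Fin n → ℤ) × (Fin n → ℤ) |
      p.1 ∈ S ∧ p.2 ∉ S ∧ p.1 ≠ p.2 ∧ ∀ i, |p.1 i - p.2 i| ≤ 1} =
      f '' ((directions n).sigma fun ε => (hfin ε).toFinset) := by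
    ext ⟨u, v⟩
    simp only [Set.mem_ofPred_eq, Set.mem_image, Finset.mem_coe, Finset.mem_sigma,
      Set.Finite.mem_toFinset, mem_directions]
    constructor
    · rintro ⟨hu, hv, hne, hd⟩
      refine ⟨⟨v - u, v⟩, ⟨⟨sub_ne_zero.2 hne.symm, fun i => ?_⟩, by simpa using hu, hv⟩,
        by simp [f]⟩
      simpa [abs_sub_comm] using hd i
    · rintro ⟨⟨ε, x⟩, ⟨⟨hne, hd⟩, hu, hv⟩, h⟩
      obtain ⟨rfl, rfl⟩ := Prod.mk.inj h
      exact ⟨hu, hv, by simpa using hne, fun i => by simpa using hd i⟩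
  rw [edgeBoundaryCard, himage, Set.ncard_image_of_injective _ hf, Set.ncard_coe_finset,
    Finset.card_sigma]
  exact Finset.sum_congr rfl fun ε _ => (Set.ncard_eq_toFinset_card _ (hfin ε)).symm

theorem edge_boundary_eq_sum_proj_add_gap
    (n : ℕ) (hn : 1 ≤ n) (S : Set (Fin n → ℤ)) (hS : S.Finite) :
    edgeBoundaryCard n S =
      ∑ ε ∈ directions n, (projCard n S ε + Set.ncard (gapSet n S ε)) := by
  rw [edgeBoundaryCard_eq_sum_ncard_exits hS]
  exact Finset.sum_congr rfl fun ε hε =>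
    ncard_exits_eq_projCard_add_ncard_gapSet hS (mem_directions.1 hε).1
end

section
/- Let n ≥ 1, let S ⊆ ℤⁿ be a finite set, and let ε ∈ {-1,0,1}ⁿ with ε ≠ 0. Then the number of points u ∈ S with u + ε ∉ S equals |P_ε(S)| + |gap_ε(S)|. -/
section DirectionalExits

variable {G : Type*} [AddCommGroup G] {S : Set G} {ε : G}

/-- The points of `S` with no further point of `S` ahead of them in direction `ε`. -/
def lastPoints (S : Set G) (ε : G) : Set G :=
  {u ∈ S | ∀ b : ℤ, 1 ≤ b → u + b • ε ∉ S}

theorem injOn_mk_lastPoints :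
    Set.InjOn (QuotientAddGroup.mk (s := AddSubgroup.zmultiples ε)) (lastPoints S ε) := by
  intro u hu v hv huv
  obtain ⟨k, hk⟩ := AddSubgroup.mem_zmultiples_iff.mp (QuotientAddGroup.eq.mp huv)
  have hv_eq : v = u + k • ε := by rw [hk]; abel
  rcases lt_trichotomy k 0 with h | rfl | h
  · refine absurd ?_ (hv.2 (-k) (by lia))
    rw [hv_eq, neg_smul, add_neg_cancel_right]
    exact hu.1
  · simpa using hv_eq.symm
  · exact absurd (hv_eq ▸ hv.1) (hu.2 k h)

theorem exists_lastPoints_add_zsmul [IsAddTorsionFree G] (hS : S.Finite) (hε : ε ≠ 0)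
    {w : G} (hw : w ∈ S) : ∃ k : ℤ, w + k • ε ∈ lastPoints S ε := by
  have hinj : Function.Injective fun b : ℤ => w + b • ε :=
    (add_right_injective w).comp (smul_left_injective ℤ hε)
  obtain ⟨k, hk, hmax⟩ := Set.exists_max_image {b : ℤ | w + b • ε ∈ S} id
    (hS.preimage hinj.injOn) ⟨0, by simpa using hw⟩
  refine ⟨k, hk, fun b hb h => ?_⟩
  have := hmax (k + b) (by simpa [add_smul, add_assoc] using h)
  simp only [id] at this
  lia

theorem image_mk_lastPoints [IsAddTorsionFree G] (hS : S.Finite) (hε : ε ≠ 0) :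
    (QuotientAddGroup.mk (s := AddSubgroup.zmultiples ε)) '' lastPoints S ε =
      QuotientAddGroup.mk '' S := by
  refine (Set.image_mono (Set.sep_subset _ _)).antisymm ?_
  rintro _ ⟨w, hw, rfl⟩
  obtain ⟨k, hk⟩ := exists_lastPoints_add_zsmul hS hε hw
  refine ⟨_, hk, (QuotientAddGroup.eq.mpr ?_).symm⟩
  exact AddSubgroup.mem_zmultiples_iff.mpr ⟨k, by abel⟩

end DirectionalExits

theorem ncard_lastPoints (n : ℕ) {S : Set (Fin n → ℤ)} (hS : S.Finite) {ε : Fin n → ℤ}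
    (hε : ε ≠ 0) : (lastPoints S ε).ncard = projCard n S ε := by
  rw [projCard, ← image_mk_lastPoints hS hε, injOn_mk_lastPoints.ncard_image]

theorem exits_eq_lastPoints_union_preimage_gapSet (n : ℕ) (S : Set (Fin n → ℤ))
    (ε : Fin n → ℤ) :
    {u ∈ S | u + ε ∉ S} = lastPoints S ε ∪ (fun u => u + ε) ⁻¹' gapSet n S ε := by
  ext u
  simp only [lastPoints, gapSet, Set.mem_union, Set.mem_preimage, Set.mem_ofPred_eq,
    add_sub_cancel_right]
  constructor
  · rintro ⟨hu, hu'⟩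
    by_cases h : ∃ b : ℤ, 1 ≤ b ∧ u + ε + b • ε ∈ S
    · exact Or.inr ⟨hu, hu', h⟩
    · refine Or.inl ⟨hu, fun b hb hbS => ?_⟩
      rcases hb.eq_or_lt with rfl | hb
      · exact hu' (by simpa using hbS)
      · refine h ⟨b - 1, by lia, ?_⟩
        rwa [add_assoc, ← one_add_zsmul, add_sub_cancel]
  · rintro (⟨hu, h⟩ | ⟨hu, hu', -⟩)
    · exact ⟨hu, by simpa using h 1 le_rfl⟩
    · exact ⟨hu, hu'⟩

theorem disjoint_lastPoints_preimage_gapSet (n : ℕ) (S : Set (Fin n → ℤ)) (ε : Fin n → ℤ) :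
    Disjoint (lastPoints S ε) ((fun u => u + ε) ⁻¹' gapSet n S ε) := by
  rw [Set.disjoint_left]
  rintro u ⟨-, hu⟩ ⟨-, -, b, hb, hbS⟩
  refine hu (1 + b) (by lia) ?_
  rwa [one_add_zsmul, ← add_assoc]

theorem card_exits_in_direction_eq_proj_add_gap
    (n : ℕ) (hn : 1 ≤ n) (S : Set (Fin n → ℤ)) (hS : S.Finite)
    (ε : Fin n → ℤ) (hε : ∀ i, ε i = -1 ∨ ε i = 0 ∨ ε i = 1) (hε0 : ε ≠ 0) :
    Set.ncard {u ∈ S | u + ε ∉ S} =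
      projCard n S ε + Set.ncard (gapSet n S ε) := by
  have hL : (lastPoints S ε).Finite := hS.subset (Set.sep_subset _ _)
  have hG : ((fun u => u + ε) ⁻¹' gapSet n S ε).Finite :=
    hS.subset fun u hu => by simpa using hu.1
  rw [exits_eq_lastPoints_union_preimage_gapSet,
    Set.ncard_union_eq (disjoint_lastPoints_preimage_gapSet n S ε) hL hG,
    ncard_lastPoints n hS hε0,
    Set.ncard_preimage_of_injective_subset_range (add_left_injective ε)
      (fun x _ => ⟨x - ε, sub_add_cancel x ε⟩)]
end

section
/- Let n ≥ 1, let S ⊆ ℤⁿ be a finite set, and fix i ∈ {1,…,n}. Let Sᵢ be the i-th central compression of S. Then |∂_e(Sᵢ)| ≤ |∂_e(S)|. -/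
/-- The centered interval of size `m`: `{x : -⌊(m-1)/2⌋ ≤ x ≤ ⌈(m-1)/2⌉}`
(empty for `m = 0`); note `⌈(m-1)/2⌉ = ⌊m/2⌋` for `m ≥ 1`. -/
def centralInterval (m : ℕ) : Set ℤ :=
  if m = 0 then ∅ else Set.Icc (-(((m - 1) / 2 : ℕ) : ℤ)) ((m / 2 : ℕ) : ℤ)

/-- The `i`-th central compression of `S`: each nonempty 1-dimensional
`i`-section of `S` is replaced by the centered interval of the same size. -/
noncomputable def centralCompression (n : ℕ) (i : Fin n) (S : Set (Fin n → ℤ)) :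
    Set (Fin n → ℤ) :=
  {u | u i ∈ centralInterval (Set.ncard {x : ℤ | Function.update u i x ∈ S})}

/-- The pairs `(x, x + d)` with `x ∈ A`, `x + d ∉ B` and `|d| ≤ 1`, recorded as `(x, d)`. -/
noncomputable def stepsOut (A B : Finset ℤ) : Finset (ℤ × ℤ) :=
  {p ∈ A ×ˢ Finset.Icc (-1) 1 | p.1 + p.2 ∉ B}

/-- The pairs `(x, x + d)` with `x ∈ A`, `x + d ∈ B` and `|d| ≤ 1`, recorded as `(x, d)`. -/
noncomputable def stepsIn (A B : Finset ℤ) : Finset (ℤ × ℤ) :=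
  {p ∈ A ×ˢ Finset.Icc (-1) 1 | p.1 + p.2 ∈ B}

theorem card_stepsIn_add_card_stepsOut (A B : Finset ℤ) :
    (stepsIn A B).card + (stepsOut A B).card = 3 * A.card := by
  rw [stepsIn, stepsOut, Finset.card_filter_add_card_filter_not, Finset.card_product]
  simp [mul_comm]

theorem card_stepsIn_comm (A B : Finset ℤ) : (stepsIn A B).card = (stepsIn B A).card := by
  refine Finset.card_nbij' (fun p => (p.1 + p.2, -p.2)) (fun p => (p.1 + p.2, -p.2)) ?_ ?_ ?_ ?_
  · rintro ⟨x, d⟩ h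
    simp [stepsIn] at h ⊢
    grind
  · rintro ⟨x, d⟩ h
    simp [stepsIn] at h ⊢
    grind
  · rintro ⟨x, d⟩ _
    simp
  · rintro ⟨x, d⟩ _
    simp

theorem card_add_two_le_card_add_card_stepsOut {A : Finset ℤ} (hA : A.Nonempty) (B : Finset ℤ) :
    A.card + 2 ≤ B.card + (stepsOut A B).card := by
  have hmin := A.min'_mem hA
  have hmax := A.max'_mem hA
  have hle := fun x hx => A.min'_le x hx
  have hge := fun x hx => A.le_max' x hx
  have hsub : insert (A.min' hA - 1) (insert (A.max' hA + 1) A) ⊆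
      B ∪ (stepsOut A B).image (fun p => p.1 + p.2) := by
    intro y hy
    by_cases hyB : y ∈ B
    · exact Finset.mem_union_left _ hyB
    refine Finset.mem_union_right _ (Finset.mem_image.2 ?_)
    rcases Finset.mem_insert.1 hy with rfl | hy
    · exact ⟨(A.min' hA, -1), by simpa [stepsOut, hmin, ← sub_eq_add_neg] using hyB, rfl⟩
    rcases Finset.mem_insert.1 hy with rfl | hy
    · exact ⟨(A.max' hA, 1), by simpa [stepsOut, hmax] using hyB, rfl⟩
    · exact ⟨(y, 0), by simp [stepsOut, hy, hyB], by simp⟩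
  have h₁ : A.max' hA + 1 ∉ A := fun h => by have := hge _ h; omega
  have h₂ : A.min' hA - 1 ∉ insert (A.max' hA + 1) A := fun h => by
    have := hle _ hmax
    rcases Finset.mem_insert.1 h with h | h
    · omega
    · have := hle _ h
      omega
  have hcard := Finset.card_le_card hsub
  rw [Finset.card_insert_of_notMem h₂, Finset.card_insert_of_notMem h₁] at hcard
  have := Finset.card_union_le B ((stepsOut A B).image (fun p => p.1 + p.2))
  have := Finset.card_image_le (s := stepsOut A B) (f := fun p => p.1 + p.2)
  omega

/-- `centralInterval m` as a finset. -/
noncomputable def centralFinset (m : ℕ) : Finset ℤ :=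
  if m = 0 then ∅ else Finset.Icc (-(((m - 1) / 2 : ℕ) : ℤ)) ((m / 2 : ℕ) : ℤ)

theorem mem_centralFinset {m : ℕ} {x : ℤ} : x ∈ centralFinset m ↔ x ∈ centralInterval m := by
  unfold centralFinset centralInterval
  split_ifs <;> simp

theorem card_centralFinset (m : ℕ) : (centralFinset m).card = m := by
  unfold centralFinset
  split_ifs with h
  · simp [h]
  · rw [Int.card_Icc]
    omega

theorem card_stepsOut_centralFinset_le {a b : ℕ} (hab : a ≤ b) :
    (stepsOut (centralFinset a) (centralFinset b)).card ≤ a + 2 - b := by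
  rcases Nat.eq_zero_or_pos a with rfl | ha
  · simp [stepsOut, centralFinset]
  have key : ∀ T : Finset (ℤ × ℤ),
      (∀ x d : ℤ, -(((a - 1) / 2 : ℕ) : ℤ) ≤ x → x ≤ ((a / 2 : ℕ) : ℤ) → -1 ≤ d → d ≤ 1 →
        (-(((b - 1) / 2 : ℕ) : ℤ) ≤ x + d → ((b / 2 : ℕ) : ℤ) < x + d) → (x, d) ∈ T) →
      (stepsOut (centralFinset a) (centralFinset b)).card ≤ T.card := by
    refine fun T hT => Finset.card_le_card ?_
    rintro ⟨x, d⟩ h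
    have hb : b ≠ 0 := by omega
    simp only [stepsOut, centralFinset, ha.ne', hb, if_false, Finset.mem_filter,
      Finset.mem_product, Finset.mem_Icc, not_and, not_le] at h
    exact hT x d h.1.1.1 h.1.1.2 h.1.2.1 h.1.2.2 h.2
  obtain rfl | rfl | h : b = a ∨ b = a + 1 ∨ a + 2 ≤ b := by omega
  · refine (key {(-(((b - 1) / 2 : ℕ) : ℤ), -1), (((b / 2 : ℕ) : ℤ), 1)} ?_).trans
      (Finset.card_le_two.trans (by omega))
    intro x d h₁ h₂ h₃ h₄ h₅
    simp only [Finset.mem_insert, Finset.mem_singleton, Prod.mk.injEq]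
    omega
  · rcases Nat.even_or_odd' a with ⟨k, rfl | rfl⟩
    · refine (key {(((2 * k / 2 : ℕ) : ℤ), 1)} ?_).trans (by simp)
      intro x d h₁ h₂ h₃ h₄ h₅
      simp only [Finset.mem_singleton, Prod.mk.injEq]
      omega
    · refine (key {(-(((2 * k + 1 - 1) / 2 : ℕ) : ℤ), -1)} ?_).trans (by simp)
      intro x d h₁ h₂ h₃ h₄ h₅
      simp only [Finset.mem_singleton, Prod.mk.injEq]
      omega
  · refine (key ∅ ?_).trans (by simp)
    intro x d h₁ h₂ h₃ h₄ h₅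
    omega

theorem card_stepsOut_centralFinset_le_of_card_le {A B : Finset ℤ} (h : A.card ≤ B.card) :
    (stepsOut (centralFinset A.card) (centralFinset B.card)).card ≤ (stepsOut A B).card := by
  have hle := card_stepsOut_centralFinset_le h
  rcases A.eq_empty_or_nonempty with rfl | hA
  · simp [stepsOut, centralFinset]
  · have := card_add_two_le_card_add_card_stepsOut hA B
    omega

theorem card_stepsOut_centralFinset_card_le (A B : Finset ℤ) :
    (stepsOut (centralFinset A.card) (centralFinset B.card)).card ≤ (stepsOut A B).card := by
  rcases le_total A.card B.card with h | h
  · exact card_stepsOut_centralFinset_le_of_card_le h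
  · have h₁ := card_stepsOut_centralFinset_le_of_card_le h
    have h₂ := card_stepsIn_add_card_stepsOut A B
    have h₃ := card_stepsIn_add_card_stepsOut B A
    have h₄ := card_stepsIn_add_card_stepsOut (centralFinset A.card) (centralFinset B.card)
    have h₅ := card_stepsIn_add_card_stepsOut (centralFinset B.card) (centralFinset A.card)
    rw [card_centralFinset] at h₄ h₅
    rw [card_stepsIn_comm B A] at h₃
    rw [card_stepsIn_comm (centralFinset B.card)] at h₅
    omega

/-- The ordered pairs counted by `edgeBoundaryCard`. -/
def edgeBoundaryPairs {n : ℕ} (S : Set (Fin n → ℤ)) : Set ((Fin n → ℤ) × (Fin n → ℤ)) :=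
  {p | p.1 ∈ S ∧ p.2 ∉ S ∧ p.1 ≠ p.2 ∧ ∀ i, |p.1 i - p.2 i| ≤ 1}

theorem Set.Finite.edgeBoundaryPairs {n : ℕ} {S : Set (Fin n → ℤ)} (hS : S.Finite) :
    (edgeBoundaryPairs S).Finite := by
  refine ((hS.prod (Set.finite_Icc (-1 : Fin n → ℤ) 1)).image
    (fun p => (p.1, p.1 + p.2))).subset ?_
  rintro ⟨u, v⟩ ⟨hu, -, -, h⟩
  refine ⟨(u, v - u), ⟨hu, fun j => ?_, fun j => ?_⟩, by simp⟩ <;>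
  · have := abs_le.1 (h j)
    dsimp only at this
    simp only [Pi.neg_apply, Pi.one_apply, Pi.sub_apply]
    omega

/-- Forget the `i`-th coordinates of a pair of points by setting them to `0`. -/
def dropCoord {n : ℕ} (i : Fin n) (p : (Fin n → ℤ) × (Fin n → ℤ)) :
    (Fin n → ℤ) × (Fin n → ℤ) :=
  (Function.update p.1 i 0, Function.update p.2 i 0)

/-- The fibre of the edge boundary over a pair of adjacent or equal lines parallel to the
`i`-th axis depends only on the sections of the set along these lines. -/
theorem ncard_edgeBoundaryPairs_fiber {n : ℕ} (i : Fin n) (S : Set (Fin n → ℤ))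
    {p q : Fin n → ℤ} (hp : p i = 0) (hq : q i = 0) (hpq : ∀ j, |p j - q j| ≤ 1)
    {A B : Finset ℤ} (hA : ∀ x, x ∈ A ↔ Function.update p i x ∈ S)
    (hB : ∀ x, x ∈ B ↔ Function.update q i x ∈ S) :
    {e ∈ edgeBoundaryPairs S | dropCoord i e = (p, q)}.ncard = (stepsOut A B).card := by
  rw [← Set.ncard_coe_finset]
  symm
  refine Set.ncard_congr
    (fun e _ => (Function.update p i e.1, Function.update q i (e.1 + e.2))) ?_ ?_ ?_
  · rintro ⟨x, d⟩ h
    simp only [stepsOut, Finset.coe_filter, Finset.mem_product, Finset.mem_Icc,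
      Set.mem_ofPred_eq, hA, hB] at h
    obtain ⟨⟨hx, hd⟩, hy⟩ := h
    refine ⟨⟨hx, hy, fun h => hy (by dsimp only at h; rwa [← h]), fun j => ?_⟩, ?_⟩
    · rcases eq_or_ne j i with rfl | hj
      · simpa [abs_le] using hd
      · simpa [hj] using hpq j
    · simp only [dropCoord, Function.update_idem]
      rw [Function.update_eq_self_iff.2 hp.symm, Function.update_eq_self_iff.2 hq.symm]
  · rintro ⟨x, d⟩ ⟨y, e⟩ - - h
    have h₁ := congrFun (congrArg Prod.fst h) i
    have h₂ := congrFun (congrArg Prod.snd h) i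
    simp only [Function.update_self] at h₁ h₂
    ext <;> simp <;> omega
  · rintro ⟨u, v⟩ ⟨⟨hu, hv, -, h⟩, he⟩
    simp only [dropCoord, Prod.mk.injEq] at he
    obtain ⟨rfl, rfl⟩ := he
    have := abs_le.1 (h i)
    refine ⟨(u i, v i - u i), ?_, by simp⟩
    simp only [stepsOut, Finset.coe_filter, Finset.mem_product, Finset.mem_Icc,
      Set.mem_ofPred_eq, hA, hB]
    simp only [Function.update_idem, Function.update_eq_self, add_sub_cancel]
    exact ⟨⟨hu, by dsimp only at this; omega, by dsimp only at this; omega⟩, hv⟩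

theorem edgeBoundary_centralCompression_le
    (n : ℕ) (hn : 1 ≤ n) (S : Set (Fin n → ℤ)) (hS : S.Finite) (i : Fin n) :
    edgeBoundaryCard n (centralCompression n i S) ≤ edgeBoundaryCard n S := by
  classical
  change (edgeBoundaryPairs (centralCompression n i S)).ncard ≤ (edgeBoundaryPairs S).ncard
  have hT := hS.edgeBoundaryPairs
  rcases (edgeBoundaryPairs (centralCompression n i S)).finite_or_infinite with hC | hC
  swap
  · simp [hC.ncard]
  have hfin : ∀ p : Fin n → ℤ, {x : ℤ | Function.update p i x ∈ S}.Finite := fun p =>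
    hS.preimage (Function.update_injective p i).injOn
  rw [Set.ncard_eq_toFinset_card _ hC, Set.ncard_eq_toFinset_card _ hT,
    Finset.card_eq_sum_card_fiberwise (f := dropCoord i)
      (t := hC.toFinset.image (dropCoord i) ∪ hT.toFinset.image (dropCoord i))
      (fun e he => Finset.mem_union_left _ (Finset.mem_image_of_mem _ he)),
    Finset.card_eq_sum_card_fiberwise (f := dropCoord i) (s := hT.toFinset)
      (t := hC.toFinset.image (dropCoord i) ∪ hT.toFinset.image (dropCoord i))
      (fun e he => Finset.mem_union_right _ (Finset.mem_image_of_mem _ he))]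
  refine Finset.sum_le_sum ?_
  rintro ⟨p, q⟩ hpq
  have hadj : ∃ e : (Fin n → ℤ) × (Fin n → ℤ),
      (∀ j, |e.1 j - e.2 j| ≤ 1) ∧ dropCoord i e = (p, q) := by
    simp only [Finset.mem_union, Finset.mem_image, Set.Finite.mem_toFinset] at hpq
    rcases hpq with ⟨e, he, h⟩ | ⟨e, he, h⟩
    exacts [⟨e, he.2.2.2, h⟩, ⟨e, he.2.2.2, h⟩]
  obtain ⟨⟨u, v⟩, huv, h⟩ := hadj
  simp only [dropCoord, Prod.mk.injEq] at h
  have hp : p i = 0 := by simp [← h.1]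
  have hq : q i = 0 := by simp [← h.2]
  have hclose : ∀ j, |p j - q j| ≤ 1 := fun j => by
    rcases eq_or_ne j i with rfl | hj
    · simp [hp, hq]
    · simpa [← h.1, ← h.2, hj] using huv j
  have hcompr : ∀ (w : Fin n → ℤ) (x : ℤ), x ∈ centralFinset (hfin w).toFinset.card ↔
      Function.update w i x ∈ centralCompression n i S := fun w x => by
    rw [mem_centralFinset, ← Set.ncard_eq_toFinset_card _ (hfin w)]
    simp [centralCompression]
  have hfibS := ncard_edgeBoundaryPairs_fiber i S hp hq hclose
    (A := (hfin p).toFinset) (B := (hfin q).toFinset) (by simp) (by simp)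
  have hfibC := ncard_edgeBoundaryPairs_fiber i _ hp hq hclose (hcompr p) (hcompr q)
  have hle := card_stepsOut_centralFinset_card_le (hfin p).toFinset (hfin q).toFinset
  rw [← hfibS, ← hfibC] at hle
  simpa only [← Set.ncard_coe_finset, Finset.coe_filter, Set.Finite.mem_toFinset] using hle
end

section
/- Let A, B ⊆ ℤ be finite sets and let b ∈ ℤ be such that b ∉ A, b ∉ B, A contains elements both strictly less than b and strictly greater than b, and B contains elements both strictly less than b and strictly greater than b (i.e., both A and B have a gap at b). Define A' = {a + 1 : a ∈ A, a < b} ∪ {a ∈ A : a > b} and B' = {c + 1 : c ∈ B, c < b} ∪ {c ∈ B : c > b}. Then E(A', B') ≤ E(A, B). -/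
/-- `E(A,B)`: the number of ordered pairs `(x, y)` with `x ∈ A`, `y ∉ B`,
`|x - y| ≤ 1`; the edges of `Gₙ` leaving the line with section `A` into the
complement of an adjacent parallel line with section `B`. -/
noncomputable def lineExitCount (A B : Set ℤ) : ℕ :=
  Set.ncard {p : ℤ × ℤ | p.1 ∈ A ∧ p.2 ∉ B ∧ |p.1 - p.2| ≤ 1}

theorem finite_setOf_lineExit {A : Set ℤ} (B : Set ℤ) (hA : A.Finite) :
    {p : ℤ × ℤ | p.1 ∈ A ∧ p.2 ∉ B ∧ |p.1 - p.2| ≤ 1}.Finite := by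
  refine ((hA.prod (Set.finite_Icc (-1 : ℤ) 1)).image (fun q => (q.1, q.1 + q.2))).subset ?_
  rintro ⟨x, y⟩ ⟨hx, -, hxy⟩
  rw [abs_le] at hxy
  refine ⟨(x, y - x), ⟨hx, ?_⟩, by simp⟩
  simp only [Set.mem_Icc] at hxy ⊢
  omega

theorem mem_shift_gap_iff {A : Set ℤ} {b x : ℤ} :
    x ∈ (fun a => a + 1) '' {a ∈ A | a < b} ∪ {a ∈ A | b < a} ↔
      (x - 1 ∈ A ∧ x ≤ b) ∨ (x ∈ A ∧ b < x) := by
  refine or_congr ⟨?_, ?_⟩ Iff.rfl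
  · rintro ⟨a, ⟨ha, hab⟩, rfl⟩
    exact ⟨by simpa using ha, hab⟩
  · rintro ⟨hx, hxb⟩
    exact ⟨x - 1, ⟨hx, by omega⟩, by simp⟩

theorem lineExitCount_shift_parallel_gap_le
    (A B : Set ℤ) (hA : A.Finite) (hB : B.Finite) (b : ℤ)
    (hbA : b ∉ A) (hbB : b ∉ B)
    (hAlt : ∃ a ∈ A, a < b) (hAgt : ∃ a ∈ A, b < a)
    (hBlt : ∃ c ∈ B, c < b) (hBgt : ∃ c ∈ B, b < c) :
    lineExitCount ((fun a => a + 1) '' {a ∈ A | a < b} ∪ {a ∈ A | b < a})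
        ((fun c => c + 1) '' {c ∈ B | c < b} ∪ {c ∈ B | b < c}) ≤
      lineExitCount A B := by
  refine Set.ncard_le_ncard_of_injOn
    (fun p => if p.1 ≤ b then (p.1 - 1, p.2 - 1) else p) ?_ ?_ (finite_setOf_lineExit B hA)
  · rintro ⟨x, y⟩ ⟨hx, hy, hxy⟩
    rw [mem_shift_gap_iff] at hx hy
    dsimp only at hx hy hxy ⊢
    rw [abs_le] at hxy
    split_ifs with hxb
    · refine ⟨hx.elim And.left fun h => absurd h.2 (by omega), fun h => ?_, ?_⟩
      · rcases le_or_gt y b with hyb | hyb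
        · exact hy (Or.inl ⟨h, hyb⟩)
        · obtain rfl : y - 1 = b := by omega
          exact hbB h
      · rw [abs_le]
        dsimp only
        omega
    · refine ⟨hx.elim (fun h => absurd h.2 hxb) And.left, fun h => ?_, abs_le.2 hxy⟩
      rcases le_or_gt y b with hyb | hyb
      · obtain rfl : y = b := by omega
        exact hbB h
      · exact hy (Or.inr ⟨h, hyb⟩)
  · rintro ⟨x, y⟩ - ⟨x', y'⟩ - h
    dsimp only at h
    split_ifs at h <;> simp only [Prod.mk.injEq] at h ⊢ <;> omega
end
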